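/- Let X be an infinite-dimensional real Banach space, let k ≥ 2 and r ≥ 1 be integers, and let R ≥ 0. Suppose that for all pairwise disjoint sets Q_1, …, Q_r in X, each of size k, there exist a partition {P_1, …, P_k} of their union with |P_i ∩ Q_j| = 1 for all i, j and a point c ∈ X such that the closed ball of radius R·max_{j ∈ [r]} diam Q_j centered at c intersects the convex hull of every P_i. Then the same conclusion holds with radius 2R·max_{j ∈ [r]} diam Q_j in any real Hilbert space: for all pairwise disjoint sets Q_1, …, Q_r in a real Hilbert space, each of size k, there exist such a transversal partition and a point c whose closed ball of radius 2R·max_{j ∈ [r]} diam Q_j intersects the convex hull of every P_i. -/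

import Mathlib

open scoped Classical

/-- The colorful no-dimensional Tverberg property of a real normed space `E` for
parameters `k`, `r` and radius factor `ρ`: for all pairwise disjoint sets
`Q_1, …, Q_r` in `E`, each of size `k`, there exist a transversal partition
`{P_1, …, P_k}` of their union (with `|P_i ∩ Q_j| = 1` for all `i, j`) and a point
`c` such that the closed ball of radius `ρ·max_j diam Q_j` centered at `c` intersects
the convex hull of every part. -/
def ColorfulTverbergProp (E : Type*) [NormedAddCommGroup E] [NormedSpace ℝ E]
    (k r : ℕ) (ρ : ℝ) : Prop :=
  ∀ Q : Fin r → Finset E,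
    (∀ j, (Q j).card = k) →
    (∀ j j', j ≠ j' → Disjoint (Q j) (Q j')) →
    ∃ Pparts : Fin k → Finset E,
      (∀ i i', i ≠ i' → Disjoint (Pparts i) (Pparts i')) ∧
      Finset.univ.biUnion Pparts = Finset.univ.biUnion Q ∧
      (∀ i j, (Pparts i ∩ Q j).card = 1) ∧
      ∃ c : E, ∀ i, ∃ p ∈ convexHull ℝ (↑(Pparts i) : Set E),
        dist p c ≤ ρ * ⨆ j, Metric.diam (↑(Q j) : Set E)

section GaussianVariance

open MeasureTheory ProbabilityTheory

variable {V : Type*} [NormedAddCommGroup V] [InnerProductSpace ℝ V] [FiniteDimensional ℝ V]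
  [MeasurableSpace V] [BorelSpace V] {X : Type*} [NormedAddCommGroup X] [NormedSpace ℝ X]

lemma integrable_of_le_sq_norm {E : Type*} [NormedAddCommGroup E] [NormedSpace ℝ E]
    [MeasurableSpace E] [BorelSpace E] [SecondCountableTopology E] [CompleteSpace E]
    (μ : Measure E) [IsGaussian μ] {g : E → ℝ} (hg : Continuous g) (C : ℝ)
    (h : ∀ x, ‖g x‖ ≤ C * ‖x‖ ^ 2) : Integrable g μ := by
  have h2 : Integrable (fun x : E => C * ‖x‖ ^ 2) μ :=
    ((memLp_two_iff_integrable_sq_norm (by fun_prop)).1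
      (IsGaussian.memLp_two_id (μ := μ))).const_mul C
  exact h2.mono' hg.aestronglyMeasurable (Filter.Eventually.of_forall h)

lemma measurePreserving_rotation_stdGaussian (θ : ℝ) :
    MeasurePreserving (fun p : V × V => (Real.cos θ • p.1 + Real.sin θ • p.2,
      -Real.sin θ • p.1 + Real.cos θ • p.2))
      ((stdGaussian V).prod (stdGaussian V)) ((stdGaussian V).prod (stdGaussian V)) := by
  refine ⟨by fun_prop, ?_⟩
  have := IsGaussian.map_rotation_eq_self (μ := stdGaussian V) (by simp) θ
  exact this

lemma measurePreserving_neg_stdGaussian :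
    MeasurePreserving (fun x : V => -x) (stdGaussian V) (stdGaussian V) :=
  ⟨by fun_prop, stdGaussian_map (LinearIsometryEquiv.neg ℝ)⟩

lemma integral_sq_strongDual_stdGaussian (L : StrongDual ℝ V) :
    ∫ x, L x ^ 2 ∂(stdGaussian V) = ‖L‖ ^ 2 := by
  rw [← variance_dual_stdGaussian L,
    variance_of_integral_eq_zero (by fun_prop) (integral_strongDual_stdGaussian L)]

omit [FiniteDimensional ℝ V] [MeasurableSpace V] [BorelSpace V] in
lemma norm_map_rotate_le (T : V →L[ℝ] X) (θ : ℝ) (p : V × V) :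
    ‖T (Real.cos θ • p.1 + Real.sin θ • p.2)‖ ≤ 2 * ‖T‖ * ‖p‖ := by
  have h1 : ‖Real.cos θ • p.1‖ ≤ ‖p‖ := by
    rw [norm_smul, Real.norm_eq_abs]
    exact (mul_le_of_le_one_left (norm_nonneg _) (Real.abs_cos_le_one θ)).trans (norm_fst_le p)
  have h2 : ‖Real.sin θ • p.2‖ ≤ ‖p‖ := by
    rw [norm_smul, Real.norm_eq_abs]
    exact (mul_le_of_le_one_left (norm_nonneg _) (Real.abs_sin_le_one θ)).trans (norm_snd_le p)
  calc _ ≤ ‖T‖ * ‖Real.cos θ • p.1 + Real.sin θ • p.2‖ := T.le_opNorm _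
    _ ≤ ‖T‖ * (‖p‖ + ‖p‖) := by gcongr; exact (norm_add_le _ _).trans (add_le_add h1 h2)
    _ = _ := by ring

lemma integrable_sq_norm_rotate_sub (T : V →L[ℝ] X) (α β : ℝ) :
    Integrable (fun p : V × V => (‖T (Real.cos α • p.1 + Real.sin α • p.2)‖ -
      ‖T (Real.cos β • p.1 + Real.sin β • p.2)‖) ^ 2)
      ((stdGaussian V).prod (stdGaussian V)) := by
  refine integrable_of_le_sq_norm _ (by fun_prop) ((2 * ‖T‖) ^ 2) fun p => ?_
  have h1 := norm_map_rotate_le T α p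
  have h2 := norm_map_rotate_le T β p
  rw [norm_pow, ← mul_pow, Real.norm_eq_abs]
  gcongr
  rw [abs_le]
  constructor <;> linarith [norm_nonneg (T (Real.cos α • p.1 + Real.sin α • p.2)),
    norm_nonneg (T (Real.cos β • p.1 + Real.sin β • p.2))]

lemma integrable_sq_posPart_norm_sub (T : V →L[ℝ] X) (θ : ℝ) :
    Integrable (fun p : V × V =>
      (max 0 (‖T p.1‖ - ‖T (Real.cos θ • p.1 + Real.sin θ • p.2)‖)) ^ 2)
      ((stdGaussian V).prod (stdGaussian V)) := by
  refine integrable_of_le_sq_norm _ (by fun_prop) ((2 * ‖T‖) ^ 2) fun p => ?_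
  have h1 := norm_map_rotate_le T 0 p
  simp only [Real.cos_zero, one_smul, Real.sin_zero, zero_smul, add_zero] at h1
  rw [norm_pow, ← mul_pow, Real.norm_eq_abs, abs_of_nonneg (le_max_left _ _)]
  gcongr
  exact max_le (by positivity) (by linarith [norm_nonneg (T (Real.cos θ • p.1 + Real.sin θ • p.2))])

omit [FiniteDimensional ℝ V] [MeasurableSpace V] [BorelSpace V] in
lemma posPart_norm_sub_sq_le (T : V →L[ℝ] X) (a b : ℝ) (x : V) :
    ∃ L : StrongDual ℝ V, ‖L‖ ≤ ‖T‖ ∧ ∀ y,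
      (max 0 (‖T x‖ - ‖T (a • x + b • y)‖)) ^ 2 ≤
        2 * (1 - a) ^ 2 * ‖T x‖ ^ 2 + 2 * b ^ 2 * L y ^ 2 := by
  obtain ⟨φ, hφ, hφx⟩ := exists_dual_vector'' ℝ (T x)
  simp only [RCLike.ofReal_real_eq_id, id_eq] at hφx
  refine ⟨φ.comp T, (φ.opNorm_comp_le T).trans
    (mul_le_of_le_one_left (norm_nonneg _) hφ), fun y => ?_⟩
  have h1 : φ (T (a • x + b • y)) ≤ ‖T (a • x + b • y)‖ :=
    (le_abs_self _).trans (by simpa using φ.le_of_opNorm_le hφ (T (a • x + b • y)))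
  have h2 : φ (T (a • x + b • y)) = a * ‖T x‖ + b * φ (T y) := by simp [hφx]
  have h3 : ‖T x‖ - ‖T (a • x + b • y)‖ ≤ (1 - a) * ‖T x‖ - b * φ (T y) := by linarith
  have h4 : (max 0 (‖T x‖ - ‖T (a • x + b • y)‖)) ^ 2 ≤ ((1 - a) * ‖T x‖ - b * φ (T y)) ^ 2 := by
    rcases le_total (‖T x‖ - ‖T (a • x + b • y)‖) 0 with h | h
    · rw [max_eq_left h, zero_pow two_ne_zero]; positivity
    · rw [max_eq_right h]; gcongr
  refine h4.trans ?_
  simp only [ContinuousLinearMap.comp_apply]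
  nlinarith [sq_nonneg ((1 - a) * ‖T x‖ + b * φ (T y))]

lemma integral_sq_posPart_norm_sub_le (T : V →L[ℝ] X) (θ : ℝ) :
    ∫ p : V × V, (max 0 (‖T p.1‖ - ‖T (Real.cos θ • p.1 + Real.sin θ • p.2)‖)) ^ 2
      ∂((stdGaussian V).prod (stdGaussian V)) ≤
      2 * ‖T‖ ^ 2 * ((1 - Real.cos θ) ^ 2 * ∫ x : V, ‖x‖ ^ 2 ∂(stdGaussian V) +
        Real.sin θ ^ 2) := by
  rw [integral_prod _ (integrable_sq_posPart_norm_sub T θ)]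
  have hint : Integrable (fun x : V => ‖x‖ ^ 2) (stdGaussian V) :=
    integrable_of_le_sq_norm _ (by fun_prop) 1 (by simp)
  calc _ ≤ ∫ x : V, (2 * (1 - Real.cos θ) ^ 2 * ‖T‖ ^ 2 * ‖x‖ ^ 2 +
        2 * Real.sin θ ^ 2 * ‖T‖ ^ 2) ∂(stdGaussian V) := by
        refine integral_mono (integrable_sq_posPart_norm_sub T θ).integral_prod_left
          ((hint.const_mul _).add (integrable_const _)) fun x => ?_
        obtain ⟨L, hL, hLy⟩ := posPart_norm_sub_sq_le T (Real.cos θ) (Real.sin θ) x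
        have hLint : Integrable (fun y : V => L y ^ 2) (stdGaussian V) :=
          (IsGaussian.memLp_dual (stdGaussian V) L 2 (by simp)).integrable_sq
        calc _ ≤ ∫ y : V, (2 * (1 - Real.cos θ) ^ 2 * ‖T x‖ ^ 2 + 2 * Real.sin θ ^ 2 * L y ^ 2)
              ∂(stdGaussian V) := by
              refine integral_mono_of_nonneg (Filter.Eventually.of_forall fun y => by positivity)
                ((integrable_const _).add (hLint.const_mul _)) (Filter.Eventually.of_forall hLy)
          _ = 2 * (1 - Real.cos θ) ^ 2 * ‖T x‖ ^ 2 + 2 * Real.sin θ ^ 2 * ‖L‖ ^ 2 := by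
              rw [integral_add (integrable_const _) (hLint.const_mul _),
                integral_const_mul (2 * Real.sin θ ^ 2), integral_sq_strongDual_stdGaussian]
              simp
          _ ≤ 2 * (1 - Real.cos θ) ^ 2 * (‖T‖ * ‖x‖) ^ 2 + 2 * Real.sin θ ^ 2 * ‖T‖ ^ 2 := by
              gcongr
              exact T.le_opNorm x
          _ = _ := by ring
    _ = _ := by
        rw [integral_add (hint.const_mul _) (integrable_const _), integral_const_mul]
        simp
        ring

lemma integral_sq_norm_sub_rotate_le (T : V →L[ℝ] X) (θ : ℝ) :
    ∫ p : V × V, (‖T (Real.cos θ • p.1 + Real.sin θ • p.2)‖ - ‖T p.1‖) ^ 2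
      ∂((stdGaussian V).prod (stdGaussian V)) ≤
      4 * ‖T‖ ^ 2 * ((1 - Real.cos θ) ^ 2 * ∫ x : V, ‖x‖ ^ 2 ∂(stdGaussian V) +
        Real.sin θ ^ 2) := by
  set μ := stdGaussian V
  set h : V × V → ℝ := fun p =>
    (max 0 (‖T p.1‖ - ‖T (Real.cos θ • p.1 + Real.sin θ • p.2)‖)) ^ 2 with hh
  have hσ : MeasurePreserving (fun p : V × V => (Real.cos θ • p.1 + Real.sin θ • p.2,
      -(-Real.sin θ • p.1 + Real.cos θ • p.2))) (μ.prod μ) (μ.prod μ) :=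
    ((MeasurePreserving.id μ).prod measurePreserving_neg_stdGaussian).comp
      (measurePreserving_rotation_stdGaussian θ)
  have hI : Integrable h (μ.prod μ) := integrable_sq_posPart_norm_sub T θ
  have hIσ : Integrable (fun p : V × V => h (Real.cos θ • p.1 + Real.sin θ • p.2,
      -(-Real.sin θ • p.1 + Real.cos θ • p.2))) (μ.prod μ) := hσ.integrable_comp_of_integrable hI
  have key : ∀ p : V × V, (‖T (Real.cos θ • p.1 + Real.sin θ • p.2)‖ - ‖T p.1‖) ^ 2 =
      h p + h (Real.cos θ • p.1 + Real.sin θ • p.2,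
        -(-Real.sin θ • p.1 + Real.cos θ • p.2)) := by
    intro p
    have hp : Real.cos θ • (Real.cos θ • p.1 + Real.sin θ • p.2) +
        Real.sin θ • -(-Real.sin θ • p.1 + Real.cos θ • p.2) = p.1 := by
      have : p.1 = (Real.cos θ ^ 2 + Real.sin θ ^ 2) • p.1 := by simp
      conv_rhs => rw [this]
      module
    simp only [hh, hp]
    rcases le_total ‖T p.1‖ ‖T (Real.cos θ • p.1 + Real.sin θ • p.2)‖ with h | h
    · rw [max_eq_left (by linarith), max_eq_right (by linarith)]; ring
    · rw [max_eq_right (by linarith), max_eq_left (by linarith)]; ring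
  simp_rw [key]
  rw [integral_add hI hIσ]
  have h2 : ∫ p, h (Real.cos θ • p.1 + Real.sin θ • p.2,
        -(-Real.sin θ • p.1 + Real.cos θ • p.2)) ∂(μ.prod μ) = ∫ p, h p ∂(μ.prod μ) := by
    rw [← integral_map (φ := fun p : V × V => (Real.cos θ • p.1 + Real.sin θ • p.2,
      -(-Real.sin θ • p.1 + Real.cos θ • p.2))) hσ.aemeasurable
      (by rw [hσ.map_eq]; exact hI.aestronglyMeasurable), hσ.map_eq]
  rw [h2]
  linarith [integral_sq_posPart_norm_sub_le T θ]

lemma integral_sq_norm_rotate_step_le (T : V →L[ℝ] X) (α θ : ℝ) :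
    ∫ p : V × V, (‖T (Real.cos (α + θ) • p.1 + Real.sin (α + θ) • p.2)‖ -
      ‖T (Real.cos α • p.1 + Real.sin α • p.2)‖) ^ 2
      ∂((stdGaussian V).prod (stdGaussian V)) ≤
      4 * ‖T‖ ^ 2 * ((1 - Real.cos θ) ^ 2 * ∫ x : V, ‖x‖ ^ 2 ∂(stdGaussian V) +
        Real.sin θ ^ 2) := by
  set μ := stdGaussian V
  have hρ := measurePreserving_rotation_stdGaussian (V := V) α
  refine le_trans (le_of_eq ?_) (integral_sq_norm_sub_rotate_le T θ)
  conv_rhs => rw [← hρ.map_eq]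
  rw [integral_map hρ.aemeasurable (Continuous.aestronglyMeasurable (by fun_prop))]
  congr with p
  congr 4
  rw [Real.cos_add, Real.sin_add]
  module

/-- A dimension-free variance bound for the norm of a Gaussian vector. -/
lemma integral_sq_norm_sub_norm_le (T : V →L[ℝ] X) :
    ∫ p : V × V, (‖T p.2‖ - ‖T p.1‖) ^ 2 ∂((stdGaussian V).prod (stdGaussian V)) ≤
      20 * ‖T‖ ^ 2 := by
  set μ := stdGaussian V
  set K := ∫ x : V, ‖x‖ ^ 2 ∂μ
  have hK : 0 ≤ K := integral_nonneg fun _ => by positivity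
  obtain ⟨N, hN⟩ := exists_nat_gt (K + 1)
  have hN1 : (1 : ℝ) < N := by linarith
  set δ := Real.pi / 2 / N with hδ
  set F : ℕ → V × V → ℝ := fun t p =>
    ‖T (Real.cos (t * δ) • p.1 + Real.sin (t * δ) • p.2)‖ with hF
  have hNδ : N * δ = Real.pi / 2 := by rw [hδ]; field_simp
  have hpt : ∀ p : V × V, (‖T p.2‖ - ‖T p.1‖) ^ 2 ≤
      N * ∑ t ∈ Finset.range N, (F (t + 1) p - F t p) ^ 2 := by
    intro p
    have := sq_sum_le_card_mul_sum_sq (s := Finset.range N) (f := fun t => F (t + 1) p - F t p)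
    rw [Finset.sum_range_sub (fun t => F t p)] at this
    simpa [hF, hNδ] using this
  have hint : ∀ t : ℕ, Integrable (fun p => (F (t + 1) p - F t p) ^ 2) (μ.prod μ) :=
    fun t => integrable_sq_norm_rotate_sub T _ _
  have hstep : ∀ t : ℕ, ∫ p, (F (t + 1) p - F t p) ^ 2 ∂(μ.prod μ) ≤
      4 * ‖T‖ ^ 2 * ((1 - Real.cos δ) ^ 2 * K + Real.sin δ ^ 2) := by
    intro t
    have := integral_sq_norm_rotate_step_le T (t * δ) δ
    simpa only [hF, Nat.cast_add, Nat.cast_one, add_mul, one_mul] using this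
  have hδ0 : 0 < δ := by positivity
  have hsin : Real.sin δ ^ 2 ≤ δ ^ 2 := by
    exact sq_le_sq.2 Real.abs_sin_le_abs
  have hcos : (1 - Real.cos δ) ^ 2 ≤ (δ ^ 2 / 2) ^ 2 := by
    have h1 := Real.one_sub_sq_div_two_le_cos (x := δ)
    have h2 := Real.cos_le_one δ
    gcongr
    linarith
  have hpi := Real.pi_lt_d2
  have hpi0 := Real.pi_pos
  calc _ ≤ ∫ p, N * ∑ t ∈ Finset.range N, (F (t + 1) p - F t p) ^ 2 ∂(μ.prod μ) :=
        integral_mono_of_nonneg (Filter.Eventually.of_forall fun y => by positivity)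
          ((integrable_finsetSum _ fun t _ => hint t).const_mul _)
          (Filter.Eventually.of_forall hpt)
    _ = N * ∑ t ∈ Finset.range N, ∫ p, (F (t + 1) p - F t p) ^ 2 ∂(μ.prod μ) := by
        rw [integral_const_mul, integral_finsetSum _ fun t _ => hint t]
    _ ≤ N * ∑ t ∈ Finset.range N, 4 * ‖T‖ ^ 2 * ((1 - Real.cos δ) ^ 2 * K + Real.sin δ ^ 2) := by
        gcongr with t; exact hstep t
    _ ≤ N * ∑ t ∈ Finset.range N, 4 * ‖T‖ ^ 2 * ((δ ^ 2 / 2) ^ 2 * K + δ ^ 2) := by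
        gcongr
    _ = ‖T‖ ^ 2 * (4 * (N * δ) ^ 2 * (1 + δ ^ 2 * K / 4)) := by
        rw [Finset.sum_const, Finset.card_range, nsmul_eq_mul]; ring
    _ ≤ ‖T‖ ^ 2 * (4 * (N * δ) ^ 2 * (1 + 1)) := by
        gcongr
        have : δ ≤ 1.58 / N := by rw [hδ]; gcongr; linarith
        have h3 : δ ^ 2 * K ≤ (1.58 / N) ^ 2 * N := by gcongr; linarith
        have h4 : (1.58 / N : ℝ) ^ 2 * N = 1.58 ^ 2 / N := by field_simp
        have h5 : (1.58 : ℝ) ^ 2 / N ≤ 1.58 ^ 2 := div_le_self (by norm_num) hN1.le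
        norm_num at h5 h4 h3 ⊢
        linarith
    _ ≤ _ := by
        rw [hNδ]
        have hpi2 : Real.pi ^ 2 ≤ 10 := by nlinarith
        nlinarith [mul_le_mul_of_nonneg_left hpi2 (sq_nonneg ‖T‖)]

lemma memLp_norm_stdGaussian (T : V →L[ℝ] X) :
    MemLp (fun x => ‖T x‖) 2 (stdGaussian V) :=
  (memLp_two_iff_integrable_sq (Continuous.aestronglyMeasurable (by fun_prop))).2 <|
    integrable_of_le_sq_norm _ (by fun_prop) (‖T‖ ^ 2) fun x => by
      rw [norm_pow, norm_norm, ← mul_pow]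
      gcongr
      exact T.le_opNorm x

lemma integrable_norm_stdGaussian (T : V →L[ℝ] X) :
    Integrable (fun x => ‖T x‖) (stdGaussian V) :=
  (memLp_norm_stdGaussian T).integrable (by norm_num)

lemma variance_norm_stdGaussian_le (T : V →L[ℝ] X) :
    Var[fun x => ‖T x‖; stdGaussian V] ≤ 10 * ‖T‖ ^ 2 := by
  set μ := stdGaussian V
  have hL := memLp_norm_stdGaussian T
  have hi := integrable_norm_stdGaussian T
  have h := integral_sq_norm_sub_norm_le T
  have h1 : Integrable (fun p : V × V => ‖T p.2‖ ^ 2) (μ.prod μ) := hL.integrable_sq.comp_snd μ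
  have h2 : Integrable (fun p : V × V => ‖T p.1‖ ^ 2) (μ.prod μ) := hL.integrable_sq.comp_fst μ
  have h3 : Integrable (fun p : V × V => ‖T p.1‖ * ‖T p.2‖) (μ.prod μ) := hi.mul_prod hi
  have e : ∀ p : V × V, (‖T p.2‖ - ‖T p.1‖) ^ 2 =
      ‖T p.2‖ ^ 2 + ‖T p.1‖ ^ 2 - 2 * (‖T p.1‖ * ‖T p.2‖) := fun p => by ring
  simp_rw [e] at h
  have h12 : Integrable (fun p : V × V => ‖T p.2‖ ^ 2 + ‖T p.1‖ ^ 2) (μ.prod μ) := h1.add h2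
  rw [integral_sub h12 (h3.const_mul 2), integral_add h1 h2, integral_const_mul,
    integral_prod_mul (fun x => ‖T x‖) (fun x => ‖T x‖),
    integral_fun_snd (fun x => ‖T x‖ ^ 2), integral_fun_fst (fun x => ‖T x‖ ^ 2)] at h
  rw [variance_eq_sub hL]
  simp only [probReal_univ, one_smul, Pi.pow_apply] at h ⊢
  nlinarith

end GaussianVariance

section MaximalDeterminant

open MeasureTheory ProbabilityTheory

open scoped InnerProductSpace

variable {V : Type*} [NormedAddCommGroup V] [InnerProductSpace ℝ V] [FiniteDimensional ℝ V]
  [MeasurableSpace V] [BorelSpace V] {X : Type*} [NormedAddCommGroup X] [NormedSpace ℝ X]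

lemma integral_norm_stdGaussian_pos {T : V →L[ℝ] X} (hT : T ≠ 0) :
    0 < ∫ x, ‖T x‖ ∂(stdGaussian V) := by
  refine lt_of_le_of_ne (integral_nonneg fun _ => norm_nonneg _) fun h => ?_
  have h0 := (integral_eq_zero_iff_of_nonneg (fun _ => norm_nonneg _)
    (integrable_norm_stdGaussian T)).1 h.symm
  obtain ⟨x, hx⟩ : ∃ x, T x ≠ 0 := by
    by_contra! hcon
    exact hT (ContinuousLinearMap.ext hcon)
  obtain ⟨φ, -, hφ⟩ := exists_dual_vector'' ℝ (T x)
  have h1 : ∫ x, (φ.comp T) x ^ 2 ∂(stdGaussian V) = 0 := by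
    refine integral_eq_zero_of_ae ?_
    filter_upwards [h0] with z hz
    have : T z = 0 := by simpa using hz
    simp [this]
  rw [integral_sq_strongDual_stdGaussian] at h1
  have h2 : φ.comp T = 0 := by simpa using h1
  have h3 := DFunLike.congr_fun h2 x
  simp only [ContinuousLinearMap.comp_apply, hφ] at h3
  exact hx (by simpa using h3)

lemma lipschitzWith_integral_norm_comp (J : V →L[ℝ] X) :
    LipschitzWith (‖J‖ * ∫ x, ‖x‖ ∂(stdGaussian V)).toNNReal
      (fun A : V →L[ℝ] V => ∫ x, ‖J (A x)‖ ∂(stdGaussian V)) := by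
  have hn : Integrable (fun x : V => ‖x‖) (stdGaussian V) := IsGaussian.integrable_id.norm
  have hnn : 0 ≤ ∫ x, ‖x‖ ∂(stdGaussian V) := integral_nonneg fun _ => norm_nonneg _
  have hJ : ∀ A : V →L[ℝ] V, Integrable (fun x => ‖J (A x)‖) (stdGaussian V) := fun A =>
    integrable_norm_stdGaussian (J.comp A)
  refine LipschitzWith.of_dist_le_mul fun A B => ?_
  rw [Real.coe_toNNReal _ (by positivity), dist_eq_norm, dist_eq_norm,
    ← integral_sub (hJ A) (hJ B)]
  refine (norm_integral_le_of_norm_le (hn.const_mul (‖J‖ * ‖A - B‖))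
    (Filter.Eventually.of_forall fun x => ?_)).trans (le_of_eq ?_)
  · calc ‖‖J (A x)‖ - ‖J (B x)‖‖ ≤ ‖J (A x) - J (B x)‖ := abs_norm_sub_norm_le _ _
      _ = ‖J ((A - B) x)‖ := by simp
      _ ≤ ‖J‖ * (‖A - B‖ * ‖x‖) := (J.le_opNorm _).trans (by gcongr; exact (A - B).le_opNorm x)
      _ = _ := by ring
  · rw [integral_const_mul]; ring

omit [MeasurableSpace V] [BorelSpace V] in
lemma ContinuousLinearMap.det_smul_eq (c : ℝ) (A : V →L[ℝ] V) :
    (c • A).det = c ^ Module.finrank ℝ V * A.det := by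
  simp [ContinuousLinearMap.det, LinearMap.det_smul]

/-- Among the multiples of the maps `J ∘ A`, one which maximizes the determinant of `A` relative
to the mean norm of the Gaussian vector. -/
lemma exists_det_le_integral_norm_pow [Nontrivial V] {J : V →L[ℝ] X}
    (hJ : Function.Injective J) :
    ∃ T : V →L[ℝ] X, ∫ x, ‖T x‖ ∂(stdGaussian V) = 1 ∧
      ∀ B : V →L[ℝ] V, |B.det| ≤ (∫ x, ‖T (B x)‖ ∂(stdGaussian V)) ^ Module.finrank ℝ V := by
  set n := Module.finrank ℝ V with hn
  have hn0 : n ≠ 0 := Module.finrank_pos.ne'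
  set ℓ : (V →L[ℝ] V) → ℝ := fun A => ∫ x, ‖J (A x)‖ ∂(stdGaussian V) with hℓ
  have hℓpos : ∀ A, A ≠ 0 → 0 < ℓ A := fun A hA =>
    integral_norm_stdGaussian_pos (T := J.comp A) fun h => hA <|
      ContinuousLinearMap.ext fun x => hJ (by simpa using DFunLike.congr_fun h x)
  have hℓcont : Continuous ℓ := (lipschitzWith_integral_norm_comp J).continuous
  have hℓsmul : ∀ (c : ℝ) A, ℓ (c • A) = |c| * ℓ A := fun c A => by
    simp only [hℓ, smul_apply, map_smul, norm_smul, Real.norm_eq_abs]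
    rw [integral_const_mul]
  have hcomp : IsCompact (Metric.sphere (0 : V →L[ℝ] V) 1) := by
    have : ProperSpace (V →L[ℝ] V) := FiniteDimensional.proper ℝ _
    exact isCompact_sphere _ _
  have hid : (1 : V →L[ℝ] V) ∈ Metric.sphere (0 : V →L[ℝ] V) 1 := by simp
  have hne : ∀ A ∈ Metric.sphere (0 : V →L[ℝ] V) 1, A ≠ 0 := fun A hA h0 => by simp [h0] at hA
  obtain ⟨A₀, hA₀, hmax⟩ := hcomp.exists_isMaxOn ⟨1, hid⟩
    (f := fun A : V →L[ℝ] V => |A.det| / ℓ A ^ n)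
    (ContinuousLinearMap.continuous_det.abs.continuousOn.div (hℓcont.pow n).continuousOn
      fun A hA => (pow_pos (hℓpos A (hne A hA)) n).ne')
  have hp₀ := hℓpos A₀ (hne A₀ hA₀)
  have hall : ∀ A : V →L[ℝ] V, |A.det| * ℓ A₀ ^ n ≤ |A₀.det| * ℓ A ^ n := by
    intro A
    rcases eq_or_ne A 0 with rfl | hA
    · have h0 : (0 : V →L[ℝ] V).det = 0 := by
        have := ContinuousLinearMap.det_smul_eq 0 (0 : V →L[ℝ] V)
        rwa [← hn, zero_pow hn0, zero_mul, zero_smul] at this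
      rw [h0]
      simp [hℓ, hn0]
    · have hA' : ‖A‖ ≠ 0 := norm_ne_zero_iff.2 hA
      have h1 := hmax (show ‖A‖⁻¹ • A ∈ Metric.sphere (0 : V →L[ℝ] V) 1 by
        simp [norm_smul, hA'])
      simp only [Set.mem_ofPred_eq, ContinuousLinearMap.det_smul_eq, hℓsmul, ← hn] at h1
      rw [abs_mul, abs_pow, mul_pow, mul_div_mul_left _ _ (by positivity),
        div_le_div_iff₀ (pow_pos (hℓpos A hA) n) (pow_pos hp₀ n)] at h1
      exact h1
  have hdet : 0 < |A₀.det| := by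
    have h1 := hall 1
    have h2 : (1 : V →L[ℝ] V).det = 1 := by simp [ContinuousLinearMap.det]
    rw [h2, abs_one, one_mul] at h1
    by_contra hcon
    have h3 : |A₀.det| = 0 := le_antisymm (not_lt.1 hcon) (abs_nonneg _)
    rw [h3, zero_mul] at h1
    exact absurd h1 (not_le.2 (pow_pos hp₀ n))
  refine ⟨(ℓ A₀)⁻¹ • J.comp A₀, ?_, fun B => ?_⟩
  · simp only [smul_apply, norm_smul, norm_inv, Real.norm_eq_abs,
      abs_of_pos hp₀, ContinuousLinearMap.comp_apply]
    rw [integral_const_mul]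
    exact inv_mul_cancel₀ hp₀.ne'
  · simp only [smul_apply, norm_smul, norm_inv, Real.norm_eq_abs,
      abs_of_pos hp₀, ContinuousLinearMap.comp_apply]
    rw [integral_const_mul]
    have h1 := hall (A₀.comp B)
    have h2 : (A₀.comp B).det = A₀.det * B.det := by
      simp [ContinuousLinearMap.det, LinearMap.det_comp]
    rw [h2, abs_mul, mul_assoc] at h1
    have h3 := le_of_mul_le_mul_left h1 hdet
    rw [mul_pow, inv_pow, inv_mul_eq_div, le_div_iff₀ (pow_pos hp₀ n)]
    exact h3

lemma indepFun_inner_sub_stdGaussian {u : V} (hu : ‖u‖ = 1) :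
    IndepFun (fun x : V => ⟪u, x⟫_ℝ) (fun x : V => x - ⟪u, x⟫_ℝ • u) (stdGaussian V) := by
  have hG : HasGaussianLaw (fun x : V => (⟪u, x⟫_ℝ, x - ⟪u, x⟫_ℝ • u)) (stdGaussian V) :=
    IsGaussian.hasGaussianLaw_id.map ((innerSL ℝ u).prod
      (ContinuousLinearMap.id ℝ V - (innerSL ℝ u).smulRight u))
  refine hG.indepFun_of_covariance_inner fun a b => ?_
  have h1 : (fun x : V => ⟪a, ⟪u, x⟫_ℝ⟫_ℝ) = fun x => ⟪a • u, x⟫_ℝ := by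
    ext x; rw [real_inner_smul_left]; simp [mul_comm]
  have h2 : (fun x : V => ⟪b, x - ⟪u, x⟫_ℝ • u⟫_ℝ) = fun x => ⟪b - ⟪b, u⟫_ℝ • u, x⟫_ℝ := by
    ext x; simp only [inner_sub_left, inner_sub_right, real_inner_smul_left, real_inner_smul_right]
    ring
  rw [h1, h2, ← covarianceBilin_apply_eq_cov IsGaussian.memLp_two_id, covarianceBilin_stdGaussian]
  change ⟪a • u, b - ⟪b, u⟫_ℝ • u⟫_ℝ = 0
  rw [inner_sub_right, real_inner_smul_left, real_inner_smul_left, real_inner_smul_right,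
    real_inner_self_eq_norm_sq, hu, real_inner_comm]
  ring

lemma integral_norm_sub_inner_smul_reflect (T : V →L[ℝ] X) {u : V} (hu : ‖u‖ = 1) (c : ℝ) :
    ∫ x, ‖T (x - ((2 - c) * ⟪u, x⟫_ℝ) • u)‖ ∂(stdGaussian V) =
      ∫ x, ‖T (x - (c * ⟪u, x⟫_ℝ) • u)‖ ∂(stdGaussian V) := by
  have hρ : ∀ x, (ℝ ∙ u).reflection x = (2 * ⟪u, x⟫_ℝ) • u - x := by
    intro x
    rw [Submodule.reflection_singleton_apply]
    simp [hu, two_smul, add_smul, two_mul]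
  conv_rhs => rw [← stdGaussian_map (ℝ ∙ u).reflection]
  rw [integral_map (by fun_prop) (Continuous.aestronglyMeasurable (by fun_prop))]
  refine integral_congr_ae (Filter.Eventually.of_forall fun x => ?_)
  simp only [hρ, inner_sub_right, real_inner_smul_right, real_inner_self_eq_norm_sq, hu]
  rw [← norm_neg, ← map_neg]
  congr 2
  module

lemma measureReal_abs_inner_stdGaussian {u : V} (hu : ‖u‖ = 1) (a : ℝ) :
    (stdGaussian V).real {x | a ≤ |⟪u, x⟫_ℝ|} = (gaussianReal 0 1).real {s | a ≤ |s|} := by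
  have h := IsGaussian.map_eq_gaussianReal (μ := stdGaussian V) (innerSL ℝ u)
  rw [integral_strongDual_stdGaussian, variance_dual_stdGaussian, innerSL_apply_norm, hu] at h
  simp only [one_pow, Real.toNNReal_one] at h
  rw [← h, map_measureReal_apply (by fun_prop)
    (measurableSet_le measurable_const (by fun_prop))]
  rfl

lemma measureReal_abs_gaussianReal_pos (a : ℝ) : 0 < (gaussianReal 0 1).real {s | a ≤ |s|} := by
  refine ENNReal.toReal_pos (fun h => ?_) (measure_ne_top _ _)
  have h1 := gaussianReal_absolutelyContinuous' 0 one_ne_zero h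
  have h2 : volume (Set.Ici a) ≤ volume {s : ℝ | a ≤ |s|} :=
    measure_mono fun s hs => le_trans (Set.mem_Ici.1 hs) (le_abs_self s)
  simp [h1] at h2

lemma integral_norm_contract_le (T : V →L[ℝ] X) (hT : ∫ x, ‖T x‖ ∂(stdGaussian V) = 1)
    {u : V} (hu : ‖u‖ = 1) (a : ℝ) :
    ∫ x, ‖T (x - ((1 / 2) * ⟪u, x⟫_ℝ) • u)‖ ∂(stdGaussian V) ≤
      1 - (gaussianReal 0 1).real {s | a ≤ |s|} * (a * ‖T u‖ - 1) / 2 := by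
  set p := (gaussianReal 0 1).real {s | a ≤ |s|} with hp
  have hI : ∀ c : ℝ, Integrable (fun x : V => ‖T (x - (c * ⟪u, x⟫_ℝ) • u)‖)
      (stdGaussian V) := fun c => by
    refine (integrable_norm_stdGaussian (T.comp (ContinuousLinearMap.id ℝ V -
      c • (innerSL ℝ u).smulRight u))).congr (Filter.Eventually.of_forall fun x => ?_)
    simp [smul_smul]
  have h32 := integral_norm_sub_inner_smul_reflect T hu (1 / 2)
  have h2 := integral_norm_sub_inner_smul_reflect T hu 0
  simp only [zero_mul, zero_smul, sub_zero, hT] at h2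
  set S : Set ℝ := {s | a ≤ |s|} with hS
  have hSm : MeasurableSet S := measurableSet_le measurable_const (by fun_prop)
  set ψ : ℝ → ℝ := S.indicator 1 with hψ
  have hψm : Measurable ψ := measurable_one.indicator hSm
  have hψint : ∫ x : V, ψ ⟪u, x⟫_ℝ ∂(stdGaussian V) = p := by
    have : (fun x : V => ψ ⟪u, x⟫_ℝ) = ((fun x : V => ⟪u, x⟫_ℝ) ⁻¹' S).indicator 1 := by
      ext x; rfl
    rw [this, integral_indicator_one (hSm.preimage (by fun_prop)), hp,
      ← measureReal_abs_inner_stdGaussian hu a]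
    rfl
  have hindep : ∫ x : V, ψ ⟪u, x⟫_ℝ * (a * ‖T u‖ - ‖T (x - (1 * ⟪u, x⟫_ℝ) • u)‖) ∂(stdGaussian V) =
      p * (a * ‖T u‖ - ∫ x, ‖T (x - (1 * ⟪u, x⟫_ℝ) • u)‖ ∂(stdGaussian V)) := by
    have h := (indepFun_inner_sub_stdGaussian hu).comp (φ := ψ)
      (ψ := fun y => a * ‖T u‖ - ‖T y‖) hψm (Continuous.measurable (by fun_prop))
    have h' := h.integral_fun_mul_eq_mul_integral
      (Measurable.aestronglyMeasurable (hψm.comp (by fun_prop)))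
      (Continuous.aestronglyMeasurable (by simp only [Function.comp_def]; fun_prop))
    simp only [Function.comp_def] at h'
    simp only [one_mul] at hI ⊢
    rw [h', hψint, integral_sub (integrable_const _) (by simpa using hI 1)]
    simp
  have hmid : ∫ x, ‖T (x - (1 * ⟪u, x⟫_ℝ) • u)‖ ∂(stdGaussian V) ≤ 1 := by
    have : ∫ x, ‖T (x - (1 * ⟪u, x⟫_ℝ) • u)‖ ∂(stdGaussian V) ≤
        ∫ x, (1 / 2 * ‖T x‖ + 1 / 2 * ‖T (x - (2 * ⟪u, x⟫_ℝ) • u)‖) ∂(stdGaussian V) := by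
      refine integral_mono (hI 1) (((integrable_norm_stdGaussian T).const_mul _).add
        ((hI 2).const_mul _)) fun x => ?_
      have : x - (1 * ⟪u, x⟫_ℝ) • u =
        (1 / 2 : ℝ) • x + (1 / 2 : ℝ) • (x - (2 * ⟪u, x⟫_ℝ) • u) := by module
      simp only [this, map_add, map_smul]
      refine (norm_add_le _ _).trans (le_of_eq ?_)
      simp [norm_smul]
    rw [integral_add ((integrable_norm_stdGaussian T).const_mul _) ((hI 2).const_mul _),
      integral_const_mul, integral_const_mul, hT, h2] at this
    linarith
  have hpt : ∀ x : V, ‖T (x - ((1 / 2) * ⟪u, x⟫_ℝ) • u)‖ +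
      ‖T (x - ((2 - 1 / 2) * ⟪u, x⟫_ℝ) • u)‖ +
      ψ ⟪u, x⟫_ℝ * (a * ‖T u‖ - ‖T (x - (1 * ⟪u, x⟫_ℝ) • u)‖) ≤
      ‖T x‖ + ‖T (x - (2 * ⟪u, x⟫_ℝ) • u)‖ := by
    intro x
    set s := ⟪u, x⟫_ℝ
    have e1 : T (x - ((1 / 2) * s) • u) =
        (1 / 2 : ℝ) • T x + (1 / 2 : ℝ) • T (x - (1 * s) • u) := by
      rw [← map_smul, ← map_smul, ← map_add]; congr 1; module
    have e2 : T (x - ((2 - 1 / 2) * s) • u) =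
        (1 / 2 : ℝ) • T (x - (2 * s) • u) + (1 / 2 : ℝ) • T (x - (1 * s) • u) := by
      rw [← map_smul, ← map_smul, ← map_add]; congr 1; module
    have e3 : (2 : ℝ) • T (x - (1 * s) • u) = T x + T (x - (2 * s) • u) := by
      rw [← map_smul, ← map_add]; congr 1; module
    have e4 : (2 * s) • T u = T x - T (x - (2 * s) • u) := by
      rw [← map_smul, ← map_sub]; congr 1; module
    have n1 := norm_add_le ((1 / 2 : ℝ) • T x) ((1 / 2 : ℝ) • T (x - (1 * s) • u))
    have n2 := norm_add_le ((1 / 2 : ℝ) • T (x - (2 * s) • u)) ((1 / 2 : ℝ) • T (x - (1 * s) • u))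
    have n3 := norm_add_le (T x) (T (x - (2 * s) • u))
    have n4 := norm_sub_le (T x) (T (x - (2 * s) • u))
    rw [← e1] at n1
    rw [← e2] at n2
    rw [← e3] at n3
    rw [← e4] at n4
    simp only [norm_smul, Real.norm_eq_abs, abs_mul] at n1 n2 n3 n4
    norm_num at n1 n2 n3 n4
    norm_num
    by_cases hs : a ≤ |s|
    · have : ψ s = 1 := Set.indicator_of_mem (s := S) hs _
      rw [this]
      have := mul_le_mul_of_nonneg_right hs (norm_nonneg (T u))
      linarith
    · have : ψ s = 0 := Set.indicator_of_notMem (s := S) hs _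
      rw [this]
      linarith
  have hψI : Integrable (fun x : V => ψ ⟪u, x⟫_ℝ *
      (a * ‖T u‖ - ‖T (x - (1 * ⟪u, x⟫_ℝ) • u)‖)) (stdGaussian V) := by
    refine Integrable.bdd_mul (c := 1) ((integrable_const _).sub (hI 1))
      (Measurable.aestronglyMeasurable (hψm.comp (by fun_prop)))
      (Filter.Eventually.of_forall fun x => ?_)
    exact (norm_indicator_le_norm_self _ _).trans (by simp)
  have hsum := integral_mono (((hI (1 / 2)).add (hI (2 - 1 / 2))).add hψI)
    ((integrable_norm_stdGaussian T).add (hI 2)) hpt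
  simp only [Pi.add_apply] at hsum
  have h12 : Integrable (fun x : V => ‖T (x - ((1 / 2) * ⟪u, x⟫_ℝ) • u)‖ +
      ‖T (x - ((2 - 1 / 2) * ⟪u, x⟫_ℝ) • u)‖) (stdGaussian V) := (hI _).add (hI _)
  rw [integral_add h12 hψI, integral_add (hI _) (hI _), h32, hindep,
    integral_add (integrable_norm_stdGaussian T) (hI 2), hT, h2] at hsum
  have hp0 : 0 ≤ p := measureReal_nonneg
  nlinarith [mul_le_mul_of_nonneg_left hmid hp0]

lemma exists_injective_of_not_finiteDimensional (hinf : ¬ FiniteDimensional ℝ X) (n : ℕ) :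
    ∃ J : EuclideanSpace ℝ (Fin n) →L[ℝ] X, Function.Injective J := by
  have hr : (n : Cardinal) ≤ Module.rank ℝ X :=
    (Cardinal.natCast_lt_aleph0).le.trans
      (not_lt.1 fun h => hinf (Module.rank_lt_aleph0_iff.1 h))
  obtain ⟨s, hs, hli⟩ := exists_finset_linearIndependent_of_le_rank hr
  have e : Fin n ≃ s := (s.equivFinOfCardEq hs).symm
  have hv : LinearIndependent ℝ (fun i : Fin n => (e i : X)) :=
    hli.linearIndependent.comp e e.injective
  refine ⟨LinearMap.toContinuousLinearMap ((Fintype.linearCombination ℝ fun i => (e i : X)) ∘ₗ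
    (EuclideanSpace.equiv (Fin n) ℝ).toLinearEquiv.toLinearMap), ?_⟩
  have := linearIndependent_iff_injective_fintypeLinearCombination.1 hv
  simpa using this.comp (EuclideanSpace.equiv (Fin n) ℝ).injective

/-- In an infinite-dimensional space there are Gaussian vectors with mean norm one and arbitrarily
small weak norm. -/
lemma exists_integral_norm_eq_one_opNorm_le (hinf : ¬ FiniteDimensional ℝ X) {τ : ℝ}
    (hτ : 0 < τ) : ∃ (n : ℕ) (T : EuclideanSpace ℝ (Fin n) →L[ℝ] X),
      ∫ x, ‖T x‖ ∂(stdGaussian (EuclideanSpace ℝ (Fin n))) = 1 ∧ ‖T‖ ≤ τ := by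
  set p := (gaussianReal 0 1).real {s | 2 / τ ≤ |s|} with hp
  have hp0 : 0 < p := measureReal_abs_gaussianReal_pos _
  have hp1 : p ≤ 1 := measureReal_le_one
  obtain ⟨n, hn⟩ := exists_pow_lt_of_lt_one (show (0 : ℝ) < 1 / 2 by norm_num)
    (show 1 - p / 2 < 1 by linarith)
  have hn0 : n ≠ 0 := by rintro rfl; norm_num at hn
  have : NeZero n := ⟨hn0⟩
  obtain ⟨J, hJ⟩ := exists_injective_of_not_finiteDimensional hinf n
  obtain ⟨T, hT, hdet⟩ := exists_det_le_integral_norm_pow hJ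
  refine ⟨n, T, hT, ContinuousLinearMap.opNorm_le_of_unit_norm hτ.le fun u hu => ?_⟩
  by_contra! hcon
  have h1 := integral_norm_contract_le T hT hu (2 / τ)
  have h2 : 2 ≤ 2 / τ * ‖T u‖ := by
    rw [div_mul_eq_mul_div, le_div_iff₀ hτ]; linarith
  set B : EuclideanSpace ℝ (Fin n) →L[ℝ] EuclideanSpace ℝ (Fin n) :=
    LinearMap.toContinuousLinearMap
      (LinearMap.transvection ((-(1 / 2 : ℝ)) • (innerSL ℝ u).toLinearMap) u) with hB
  have hBdet : B.det = 1 / 2 := by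
    simp only [ContinuousLinearMap.det, hB, LinearMap.coe_toContinuousLinearMap,
      LinearMap.transvection.det]
    simp [hu]
    norm_num
  have hBx : ∀ x, B x = x - ((1 / 2) * ⟪u, x⟫_ℝ) • u := fun x => by
    simp [hB, LinearMap.transvection, sub_eq_add_neg]
  have h3 := hdet B
  simp only [hBx, finrank_euclideanSpace_fin, hBdet] at h3
  have h4 : (∫ x, ‖T (x - ((1 / 2) * ⟪u, x⟫_ℝ) • u)‖
      ∂(stdGaussian (EuclideanSpace ℝ (Fin n)))) ^ n ≤ (1 - p / 2) ^ n := by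
    refine pow_le_pow_left₀ (integral_nonneg fun _ => norm_nonneg _) (h1.trans ?_) n
    nlinarith
  rw [abs_of_pos (by norm_num)] at h3
  linarith

end MaximalDeterminant

section Dvoretzky

open MeasureTheory ProbabilityTheory

variable {X : Type*} [NormedAddCommGroup X] [NormedSpace ℝ X]

lemma map_stdGaussian_of_exists_inner_eq {E V : Type*}
    [NormedAddCommGroup E] [InnerProductSpace ℝ E] [FiniteDimensional ℝ E]
    [MeasurableSpace E] [BorelSpace E]
    [NormedAddCommGroup V] [InnerProductSpace ℝ V] [FiniteDimensional ℝ V]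
    [MeasurableSpace V] [BorelSpace V] (L : E →L[ℝ] V)
    (hL : ∀ t : V, ∃ t' : E, ‖t'‖ = ‖t‖ ∧ ∀ x, inner ℝ (L x) t = inner ℝ x t') :
    (stdGaussian E).map L = stdGaussian V := by
  have : IsFiniteMeasure ((stdGaussian E).map L) := inferInstance
  refine Measure.ext_of_charFun (funext fun t => ?_)
  obtain ⟨t', ht', h⟩ := hL t
  rw [charFun_stdGaussian, ← ht', ← charFun_stdGaussian t', charFun_apply, charFun_apply,
    integral_map (by fun_prop) (Continuous.aestronglyMeasurable (by fun_prop))]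
  simp only [h]

/-- Multiplication of the matrix `G` by the vector `a`, as a bilinear map. -/
noncomputable def EuclideanSpace.mulVecBilin (ι κ : Type*) [Fintype ι] [Fintype κ] :
    EuclideanSpace ℝ κ →ₗ[ℝ] EuclideanSpace ℝ (ι × κ) →ₗ[ℝ] EuclideanSpace ℝ ι :=
  LinearMap.mk₂ ℝ (fun a G => WithLp.toLp 2 fun i => ∑ j, a j * G (i, j))
    (fun a b G => by ext i; simp [add_mul, Finset.sum_add_distrib])
    (fun c a G => by ext i; simp [mul_assoc, Finset.mul_sum])
    (fun a G G' => by ext i; simp [mul_add, Finset.sum_add_distrib])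
    (fun c a G => by ext i; simp [mul_left_comm, Finset.mul_sum])

lemma map_mulVecBilin_stdGaussian {ι κ : Type*} [Fintype ι] [Fintype κ] {a : EuclideanSpace ℝ κ}
    (ha : ‖a‖ = 1) :
    (stdGaussian (EuclideanSpace ℝ (ι × κ))).map (EuclideanSpace.mulVecBilin ι κ a) =
      stdGaussian (EuclideanSpace ℝ ι) := by
  refine map_stdGaussian_of_exists_inner_eq
    (LinearMap.toContinuousLinearMap (EuclideanSpace.mulVecBilin ι κ a)) fun t =>
    ⟨WithLp.toLp 2 fun q => t q.1 * a q.2, ?_, fun x => ?_⟩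
  · refine (sq_eq_sq₀ (norm_nonneg _) (norm_nonneg _)).1 ?_
    have ha' : ∑ j, a j ^ 2 = 1 := by
      have := EuclideanSpace.norm_sq_eq a
      simpa [ha] using this.symm
    simp [EuclideanSpace.norm_sq_eq, Fintype.sum_prod_type, mul_pow, ← Finset.mul_sum, ha']
  · simp [EuclideanSpace.mulVecBilin, PiLp.inner_apply, Fintype.sum_prod_type, Finset.mul_sum]
    exact Finset.sum_congr rfl fun i _ => Finset.sum_congr rfl fun j _ => by ring

lemma measureReal_le_abs_norm_sub_integral_le {V : Type*} [NormedAddCommGroup V]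
    [InnerProductSpace ℝ V] [FiniteDimensional ℝ V] [MeasurableSpace V] [BorelSpace V]
    (T : V →L[ℝ] X) {c : ℝ} (hc : 0 < c) :
    (stdGaussian V).real {x | c ≤ |‖T x‖ - ∫ y, ‖T y‖ ∂(stdGaussian V)|} ≤
      10 * ‖T‖ ^ 2 / c ^ 2 := by
  have h := meas_ge_le_variance_div_sq (memLp_norm_stdGaussian T) hc
  have h1 := ENNReal.toReal_mono ENNReal.ofReal_ne_top h
  rw [ENNReal.toReal_ofReal (div_nonneg (variance_nonneg _ _) (sq_nonneg _))] at h1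
  exact h1.trans (by gcongr; exact variance_norm_stdGaussian_le T)

/-- A linear map which almost preserves the norm on a `δ`-net of the unit sphere almost preserves
the norm. -/
lemma norm_bounds_of_net {E : Type*} [NormedAddCommGroup E] [NormedSpace ℝ E] (S : E →L[ℝ] X)
    {ε : ℝ} (hε : 0 < ε) (hε1 : ε ≤ 1 / 2)
    (h : ∀ w : E, ‖w‖ = 1 → ∃ a, ‖w - a‖ ≤ ε ∧ |‖S a‖ - 1| ≤ ε) (w : E) :
    (1 - 4 * ε) * ‖w‖ ≤ ‖S w‖ ∧ ‖S w‖ ≤ (1 + 4 * ε) * ‖w‖ := by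
  have hS : ‖S‖ ≤ 1 + ε + ε * ‖S‖ := by
    refine ContinuousLinearMap.opNorm_le_of_unit_norm (by positivity) fun w hw => ?_
    obtain ⟨a, ha, hSa⟩ := h w hw
    have h1 : ‖S (w - a)‖ ≤ ‖S‖ * ε := S.le_of_opNorm_le_of_le le_rfl ha
    have h2 := norm_sub_norm_le (S w) (S a)
    rw [← map_sub] at h2
    linarith [(abs_le.1 hSa).2]
  have hS' : ‖S‖ ≤ 1 + 4 * ε := by nlinarith
  refine ⟨?_, S.le_of_opNorm_le hS' w⟩
  rcases eq_or_ne w 0 with rfl | hw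
  · simp
  have hw' : 0 < ‖w‖ := norm_pos_iff.2 hw
  obtain ⟨a, ha, hSa⟩ := h (‖w‖⁻¹ • w) (by simp [norm_smul, hw])
  have h1 : ‖S (‖w‖⁻¹ • w - a)‖ ≤ (1 + 4 * ε) * ε := S.le_of_opNorm_le_of_le hS' ha
  have h2 := norm_sub_norm_le (S a) (S (‖w‖⁻¹ • w))
  rw [← norm_sub_rev, ← map_sub] at h2
  have h3 : 1 - 4 * ε ≤ ‖S (‖w‖⁻¹ • w)‖ := by nlinarith [(abs_le.1 hSa).1]
  rw [map_smul, norm_smul, norm_inv, norm_norm, inv_mul_eq_div, le_div_iff₀ hw'] at h3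
  exact h3

/-- **Dvoretzky's theorem**, in qualitative form. -/
lemma exists_almost_isometry_of_not_finiteDimensional (hinf : ¬ FiniteDimensional ℝ X) (m : ℕ)
    {ε : ℝ} (hε : 0 < ε) : ∃ S : EuclideanSpace ℝ (Fin m) →L[ℝ] X,
      ∀ w, (1 - ε) * ‖w‖ ≤ ‖S w‖ ∧ ‖S w‖ ≤ (1 + ε) * ‖w‖ := by
  set e := min (ε / 4) (1 / 2) with he
  have he0 : 0 < e := by positivity
  obtain ⟨N, hNs, hNf, hN⟩ :=
    (isCompact_sphere (0 : EuclideanSpace ℝ (Fin m)) 1).finite_cover_balls he0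
  lift N to Finset (EuclideanSpace ℝ (Fin m)) using hNf
  set τ := e / (4 * (N.card + 1)) with hτ
  have hτ0 : 0 < τ := by positivity
  obtain ⟨n, T, hT, hTτ⟩ := exists_integral_norm_eq_one_opNorm_le hinf hτ0
  set P := EuclideanSpace.mulVecBilin (Fin n) (Fin m) with hP
  set bad : EuclideanSpace ℝ (Fin m) → Set (EuclideanSpace ℝ (Fin n × Fin m)) := fun a =>
    P a ⁻¹' {x | e ≤ |‖T x‖ - 1|} with hbad
  have hmeas : ∀ a ∈ N,
      (stdGaussian (EuclideanSpace ℝ (Fin n × Fin m))).real (bad a) ≤ 10 * τ ^ 2 / e ^ 2 := by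
    intro a ha
    have h1 := measureReal_le_abs_norm_sub_integral_le T he0
    rw [hT, ← map_mulVecBilin_stdGaussian (κ := Fin m) (by simpa using hNs ha),
      map_measureReal_apply
        (LinearMap.continuous_of_finiteDimensional _).measurable
        (measurableSet_le measurable_const (Continuous.measurable (by fun_prop)))] at h1
    exact h1.trans (by gcongr)
  have hunion : (stdGaussian (EuclideanSpace ℝ (Fin n × Fin m))).real (⋃ a ∈ N, bad a) < 1 := by
    refine (measureReal_biUnion_finset_le _ _).trans_lt ((Finset.sum_le_sum hmeas).trans_lt ?_)
    have hτe : 10 * τ ^ 2 / e ^ 2 = 10 / (16 * ((N.card : ℝ) + 1) ^ 2) := by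
      rw [hτ]; field_simp; ring
    rw [Finset.sum_const, nsmul_eq_mul, hτe, ← mul_div_assoc, div_lt_one (by positivity)]
    nlinarith [Nat.cast_nonneg (α := ℝ) N.card]
  obtain ⟨G, hG⟩ : ∃ G, G ∉ ⋃ a ∈ N, bad a := by
    by_contra! hcon
    rw [Set.eq_univ_of_forall hcon, probReal_univ] at hunion
    exact lt_irrefl _ hunion
  simp only [Set.mem_iUnion, not_exists, hbad, Set.mem_preimage, Set.mem_ofPred_eq, not_le] at hG
  refine ⟨T.comp (LinearMap.toContinuousLinearMap (P.flip G)), fun w => ?_⟩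
  have := norm_bounds_of_net (T.comp (LinearMap.toContinuousLinearMap (P.flip G))) he0
    (min_le_right _ _) (fun w hw => ?_) w
  · have h4 : 4 * e ≤ ε := by linarith [min_le_left (ε / 4) (1 / 2)]
    refine ⟨le_trans ?_ this.1, this.2.trans ?_⟩ <;> gcongr
  · obtain ⟨a, ha, haw⟩ := Set.mem_iUnion₂.1 (hN (by simpa using hw))
    refine ⟨a, ?_, ?_⟩
    · rw [← dist_eq_norm]
      exact (Metric.mem_ball.1 haw).le
    · exact (hG a ha).le

end Dvoretzky

section Transfer

/-- The transversal partitions of a family of finite sets. -/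
def IsTransversalPartition {E : Type*} {k r : ℕ} (Q : Fin r → Finset E) (P : Fin k → Finset E) :
    Prop :=
  (∀ i i', i ≠ i' → Disjoint (P i) (P i')) ∧
    Finset.univ.biUnion P = Finset.univ.biUnion Q ∧ ∀ i j, (P i ∩ Q j).card = 1

lemma IsTransversalPartition.subset {E : Type*} {k r : ℕ} {Q : Fin r → Finset E}
    {P : Fin k → Finset E} (h : IsTransversalPartition Q P) (i : Fin k) :
    P i ⊆ Finset.univ.biUnion Q :=
  h.2.1 ▸ Finset.subset_biUnion_of_mem P (Finset.mem_univ i)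

lemma finite_setOf_isTransversalPartition {E : Type*} {k r : ℕ} (Q : Fin r → Finset E) :
    {P : Fin k → Finset E | IsTransversalPartition Q P}.Finite :=
  (Fintype.piFinset fun _ : Fin k => (Finset.univ.biUnion Q).powerset).finite_toSet.subset
    fun P hP => by
      simpa only [Finset.mem_coe, Fintype.mem_piFinset, Finset.mem_powerset] using hP.subset

lemma IsTransversalPartition.of_image {E F : Type*} {k r : ℕ} {Q : Fin r → Finset E} {f : E → F}
    (hf : Set.InjOn f (Finset.univ.biUnion Q : Finset E)) {P : Fin k → Finset F}
    (hP : IsTransversalPartition (fun j => (Q j).image f) P) :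
    ∃ P' : Fin k → Finset E, IsTransversalPartition Q P' ∧ ∀ i, (P' i).image f = P i := by
  set U := Finset.univ.biUnion Q with hU
  have hQU : ∀ j, Q j ⊆ U := fun j => Finset.subset_biUnion_of_mem Q (Finset.mem_univ j)
  have hUf : Finset.univ.biUnion P = U.image f := by
    rw [hP.2.1, hU, Finset.biUnion_image]
  have himage : ∀ i, (U.filter fun x => f x ∈ P i).image f = P i := by
    intro i
    ext y
    simp only [Finset.mem_image, Finset.mem_filter]
    refine ⟨fun ⟨x, hx, hxy⟩ => hxy ▸ hx.2, fun hy => ?_⟩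
    have : y ∈ U.image f := hUf ▸ Finset.mem_biUnion.2 ⟨i, Finset.mem_univ _, hy⟩
    obtain ⟨x, hx, rfl⟩ := Finset.mem_image.1 this
    exact ⟨x, ⟨hx, hy⟩, rfl⟩
  refine ⟨fun i => U.filter fun x => f x ∈ P i, ⟨fun i i' hii => ?_, ?_, fun i j => ?_⟩, himage⟩
  · refine Finset.disjoint_left.2 fun x hx hx' => ?_
    exact Finset.disjoint_left.1 (hP.1 i i' hii) (Finset.mem_filter.1 hx).2
      (Finset.mem_filter.1 hx').2
  · refine Finset.ext fun x => ?_
    rw [← hU]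
    simp only [Finset.mem_biUnion, Finset.mem_univ, true_and, Finset.mem_filter]
    refine ⟨fun ⟨i, hx, _⟩ => hx, fun hx => ?_⟩
    have : f x ∈ Finset.univ.biUnion P := hUf ▸ Finset.mem_image_of_mem f hx
    obtain ⟨i, -, hi⟩ := Finset.mem_biUnion.1 this
    exact ⟨i, hx, hi⟩
  · rw [← hP.2.2 i j, ← Finset.card_image_of_injOn (f := f) (hf.mono fun x hx =>
      (Finset.mem_filter.1 (Finset.mem_inter.1 hx).1).1)]
    congr 1
    ext y
    simp only [Finset.mem_image, Finset.mem_inter, Finset.mem_filter]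
    constructor
    · rintro ⟨x, ⟨⟨-, hx⟩, hxQ⟩, rfl⟩
      exact ⟨hx, x, hxQ, rfl⟩
    · rintro ⟨hy, x, hxQ, rfl⟩
      exact ⟨x, ⟨⟨hQU j hxQ, hy⟩, hxQ⟩, rfl⟩

lemma ColorfulTverbergProp.exists_norm_map_sub_le {X E : Type*} [NormedAddCommGroup X]
    [NormedSpace ℝ X] [NormedAddCommGroup E] [NormedSpace ℝ E] {k r : ℕ} {R : ℝ}
    (hX : ColorfulTverbergProp X k r R) (S : E →ₗ[ℝ] X) {Q : Fin r → Finset E}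
    (hQ : ∀ j, (Q j).card = k) (hdisj : ∀ j j', j ≠ j' → Disjoint (Q j) (Q j'))
    (hS : Set.InjOn S (Finset.univ.biUnion Q : Finset E)) :
    ∃ P : Fin k → Finset E, IsTransversalPartition Q P ∧ ∃ p : Fin k → E,
      (∀ i, p i ∈ convexHull ℝ (P i : Set E)) ∧
      ∀ i i', ‖S (p i - p i')‖ ≤ 2 * R * ⨆ j, Metric.diam (S '' (Q j : Set E)) := by
  have hQU : ∀ j, Q j ⊆ Finset.univ.biUnion Q := fun j =>
    Finset.subset_biUnion_of_mem Q (Finset.mem_univ j)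
  obtain ⟨P', h1, h2, h3, c, hc⟩ := hX (fun j => (Q j).image S)
    (fun j => by rw [Finset.card_image_of_injOn (hS.mono (hQU j)), hQ])
    (fun j j' hj => by
      refine Finset.disjoint_left.2 fun y hy hy' => ?_
      obtain ⟨x, hx, rfl⟩ := Finset.mem_image.1 hy
      obtain ⟨x', hx', hxx⟩ := Finset.mem_image.1 hy'
      have := hS (hQU _ hx') (hQU _ hx) hxx
      exact Finset.disjoint_left.1 (hdisj j j' hj) hx (this ▸ hx'))
  obtain ⟨P, hP, hPP⟩ := IsTransversalPartition.of_image hS ⟨h1, h2, h3⟩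
  refine ⟨P, hP, ?_⟩
  have : ∀ i, ∃ p ∈ convexHull ℝ (P i : Set E),
      dist (S p) c ≤ R * ⨆ j, Metric.diam (S '' (Q j : Set E)) := by
    intro i
    obtain ⟨q, hq, hqc⟩ := hc i
    rw [← hPP, Finset.coe_image, ← LinearMap.image_convexHull] at hq
    obtain ⟨p, hp, rfl⟩ := hq
    exact ⟨p, hp, by simpa using hqc⟩
  choose p hp hpc using this
  refine ⟨p, hp, fun i i' => ?_⟩
  rw [map_sub, ← dist_eq_norm]
  linarith [dist_triangle_right (S (p i)) (S (p i')) c, hpc i, hpc i']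

lemma iSup_diam_image_le {E X : Type*} [NormedAddCommGroup E] [NormedAddCommGroup X] {r : ℕ}
    (hr : 1 ≤ r) (Q : Fin r → Finset E) (S : E → X) {C : ℝ} (hC : 0 ≤ C)
    (hS : ∀ j, ∀ x ∈ Q j, ∀ y ∈ Q j, dist (S x) (S y) ≤ C * dist x y) :
    ⨆ j, Metric.diam (S '' (Q j : Set E)) ≤ C * ⨆ j, Metric.diam (Q j : Set E) := by
  have : Nonempty (Fin r) := ⟨⟨0, hr⟩⟩
  refine ciSup_le fun j => ?_
  have hle : Metric.diam (Q j : Set E) ≤ ⨆ j, Metric.diam (Q j : Set E) :=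
    le_ciSup (f := fun j => Metric.diam (Q j : Set E)) (Set.finite_range _).bddAbove j
  refine (Metric.diam_le_of_forall_dist_le (C := C * Metric.diam (Q j : Set E))
    (by positivity) ?_).trans (by gcongr)
  rintro _ ⟨x, hx, rfl⟩ _ ⟨y, hy, rfl⟩
  refine (hS j x hx y hy).trans ?_
  gcongr
  exact Metric.dist_le_diam_of_mem (Q j).finite_toSet.isBounded hx hy

lemma ColorfulTverbergProp.exists_dist_le_of_not_finiteDimensional {X : Type*}
    [NormedAddCommGroup X] [NormedSpace ℝ X] (hinf : ¬ FiniteDimensional ℝ X) {k r : ℕ}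
    (hr : 1 ≤ r) {R : ℝ} (hR : 0 ≤ R) (hX : ColorfulTverbergProp X k r R) {H : Type*}
    [NormedAddCommGroup H] [InnerProductSpace ℝ H] {Q : Fin r → Finset H}
    (hQ : ∀ j, (Q j).card = k) (hdisj : ∀ j j', j ≠ j' → Disjoint (Q j) (Q j')) {ε : ℝ}
    (hε : 0 < ε) (hε1 : ε < 1) :
    ∃ P : Fin k → Finset H, IsTransversalPartition Q P ∧ ∃ p : Fin k → H,
      (∀ i, p i ∈ convexHull ℝ (P i : Set H)) ∧
      ∀ i i', (1 - ε) * dist (p i) (p i') ≤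
        2 * R * ((1 + ε) * ⨆ j, Metric.diam (Q j : Set H)) := by
  set W := Submodule.span ℝ ((Finset.univ.biUnion Q : Finset H) : Set H) with hW
  have hUW : ((Finset.univ.biUnion Q : Finset H) : Set H) ⊆ W := Submodule.subset_span
  have hQU : ∀ j, Q j ⊆ Finset.univ.biUnion Q := fun j =>
    Finset.subset_biUnion_of_mem Q (Finset.mem_univ j)
  have : FiniteDimensional ℝ W := FiniteDimensional.span_finset ℝ _
  obtain ⟨S₀, hS₀⟩ := exists_almost_isometry_of_not_finiteDimensional hinf
    (Module.finrank ℝ W) hε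
  set S : H →ₗ[ℝ] X := S₀.toLinearMap ∘ₗ
    (stdOrthonormalBasis ℝ W).repr.toLinearEquiv.toLinearMap ∘ₗ
      W.orthogonalProjectionOnto.toLinearMap with hSdef
  have hS : ∀ w ∈ W, (1 - ε) * ‖w‖ ≤ ‖S w‖ ∧ ‖S w‖ ≤ (1 + ε) * ‖w‖ := by
    intro w hw
    have := hS₀ ((stdOrthonormalBasis ℝ W).repr ⟨w, hw⟩)
    simpa [hSdef, Submodule.orthogonalProjectionOnto_mem_subspace_eq_self (⟨w, hw⟩ : W)] using this
  have hinj : Set.InjOn S (Finset.univ.biUnion Q : Finset H) := by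
    intro x hx y hy hxy
    have h1 := (hS (x - y) (W.sub_mem (hUW hx) (hUW hy))).1
    rw [map_sub, hxy, sub_self, norm_zero] at h1
    have h2 : ‖x - y‖ = 0 := by nlinarith [norm_nonneg (x - y)]
    exact sub_eq_zero.1 (norm_eq_zero.1 h2)
  obtain ⟨P, hP, p, hp, hpS⟩ := hX.exists_norm_map_sub_le S hQ hdisj hinj
  have hpW : ∀ i, p i ∈ W := fun i =>
    convexHull_min ((Finset.coe_subset.2 (hP.subset i)).trans hUW) W.convex (hp i)
  refine ⟨P, hP, p, hp, fun i i' => ?_⟩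
  rw [dist_eq_norm]
  refine (hS _ (W.sub_mem (hpW i) (hpW i'))).1.trans ((hpS i i').trans ?_)
  gcongr
  refine iSup_diam_image_le hr Q S (by positivity) fun j x hx y hy => ?_
  rw [dist_eq_norm, dist_eq_norm, ← map_sub]
  exact (hS _ (W.sub_mem (hUW (hQU j hx)) (hUW (hQU j hy)))).2

end Transfer

/-- **Transfer from an infinite-dimensional Banach space to Hilbert spaces**
(cf. `R_c(ℓ₂,k,r) ≤ 2·R_c(X,k,r)` via Dvoretzky's theorem). If an
infinite-dimensional real Banach space `X` satisfies the colorful no-dimensional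
Tverberg property with radius factor `R ≥ 0`, then every real Hilbert space
satisfies it with radius factor `2R`. -/
theorem hilbert_tverberg_of_infinite_dimensional_banach
    {X : Type*} [NormedAddCommGroup X] [NormedSpace ℝ X] [CompleteSpace X]
    (hinf : ¬ FiniteDimensional ℝ X)
    (k r : ℕ) (hk : 2 ≤ k) (hr : 1 ≤ r) (R : ℝ) (hR : 0 ≤ R)
    (hX : ColorfulTverbergProp X k r R) :
    ∀ (H : Type*) [NormedAddCommGroup H] [InnerProductSpace ℝ H] [CompleteSpace H],
      ColorfulTverbergProp H k r (2 * R) := by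
  intro H _ _ _ Q hQ hdisj
  set D := ⨆ j, Metric.diam (Q j : Set H) with hD
  have : NeZero k := ⟨by lia⟩
  set K : Set (Fin k → H) := ⋃ P ∈ {P : Fin k → Finset H | IsTransversalPartition Q P},
    Set.univ.pi fun i => convexHull ℝ (P i : Set H) with hK
  have hKc : IsCompact K := (finite_setOf_isTransversalPartition Q).isCompact_biUnion fun P _ =>
    isCompact_univ_pi fun i => (P i).finite_toSet.isCompact_convexHull (𝕜 := ℝ)
  have happrox : ∀ ε : ℝ, 0 < ε → ε < 1 → ∃ p ∈ K,
      (1 - ε) * dist p (fun _ => p 0) ≤ 2 * R * ((1 + ε) * D) := by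
    intro ε hε hε1
    obtain ⟨P, hP, p, hp, hpd⟩ :=
      hX.exists_dist_le_of_not_finiteDimensional hinf hr hR hQ hdisj hε hε1
    refine ⟨p, Set.mem_biUnion hP fun i _ => hp i, ?_⟩
    rw [← le_div_iff₀' (by linarith)]
    refine (dist_pi_le_iff').2 fun i => ?_
    rw [le_div_iff₀' (by linarith)]
    exact hpd i 0
  obtain ⟨p₁, hp₁, -⟩ := happrox (1 / 2) (by norm_num) (by norm_num)
  obtain ⟨p, hp, hmin⟩ := hKc.exists_isMinOn ⟨p₁, hp₁⟩
    (f := fun p : Fin k → H => dist p (fun _ => p 0)) (by fun_prop)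
  have hle : dist p (fun _ => p 0) ≤ 2 * R * D := by
    have htend : ∀ f : ℝ → ℝ, Continuous f →
        Filter.Tendsto f (nhdsWithin 0 (Set.Ioi 0)) (nhds (f 0)) := fun f hf =>
      hf.continuousAt.tendsto.mono_left nhdsWithin_le_nhds
    have h := le_of_tendsto_of_tendsto
      (htend (fun ε => (1 - ε) * dist p (fun _ => p 0)) (by fun_prop))
      (htend (fun ε => 2 * R * ((1 + ε) * D)) (by fun_prop)) (by
        filter_upwards [Ioo_mem_nhdsGT (show (0 : ℝ) < 1 by norm_num)] with ε hε
        obtain ⟨q, hq, hqd⟩ := happrox ε hε.1 hε.2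
        refine le_trans ?_ hqd
        have : 0 ≤ 1 - ε := by linarith [hε.2]
        gcongr
        exact hmin hq)
    simpa using h
  obtain ⟨P, hP, hpP⟩ := Set.mem_iUnion₂.1 hp
  refine ⟨P, hP.1, hP.2.1, hP.2.2, p 0, fun i => ⟨p i, hpP i (Set.mem_univ i), ?_⟩⟩
  exact (dist_le_pi_dist p (fun _ => p 0) i).trans hle
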